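/- Partition X̃ = (X̃_1 x̃_p) into its first p−1 columns and its last column, assume X̃_1^T X̃_1 is invertible, and let r_p² = (x̃_p^T X̃_1 (X̃_1^T X̃_1)^{-1} X̃_1^T x̃_p)/(x̃_p^T x̃_p) be the squared multiple correlation coefficient of the p-th regressor with the remaining regressors, and s_p² = (1/n) x̃_p^T x̃_p the data variance of the p-th regressor. Then 1 − r_p² = 1 / (s_p² b_pp²), where b_pp is the (p,p) entry of B. -/

import Mathlib

open Matrix

/-- The residual of regressing `y` on the columns of `Z` is orthogonal to these columns. -/
lemma transpose_mulVec_residual {m k : Type*} [Fintype m] [Fintype k] [DecidableEq k]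
    (Z : Matrix m k ℝ) (y : m → ℝ) (hZ : IsUnit (Zᵀ * Z).det) :
    Zᵀ *ᵥ (y - Z *ᵥ ((Zᵀ * Z)⁻¹ *ᵥ (Zᵀ *ᵥ y))) = 0 := by
  rw [mulVec_sub, mulVec_mulVec, mulVec_mulVec, mul_nonsing_inv _ hZ, one_mulVec, sub_self]

/-- A lower triangular matrix and its inverse have reciprocal last diagonal entries. -/
lemma inv_last_mul_last {q : ℕ} (A : Matrix (Fin (q + 1)) (Fin (q + 1)) ℝ)
    (hlow : ∀ i j, i < j → A i j = 0) (hA : IsUnit A.det) :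
    A⁻¹ (Fin.last q) (Fin.last q) * A (Fin.last q) (Fin.last q) = 1 := by
  have h := congrFun₂ (nonsing_inv_mul A hA) (Fin.last q) (Fin.last q)
  simpa [mul_apply, Fin.sum_univ_castSucc, hlow _ _ (Fin.castSucc_lt_last _)] using h

/-- The residual sum of squares of the last column of `Y` on the other columns, in terms of
the Cholesky root of `c • (Yᵀ * Y)`. -/
lemma residual_mul_inv_last_sq {m : Type*} [Fintype m] {q : ℕ} (c : ℝ)
    (Y : Matrix m (Fin (q + 1)) ℝ) (A : Matrix (Fin (q + 1)) (Fin (q + 1)) ℝ)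
    (hlow : ∀ i j, i < j → A i j = 0) (hdet : IsUnit A.det)
    (hA : c • (Yᵀ * Y) = A * Aᵀ)
    (Z : Matrix m (Fin q) ℝ) (hZ : Z = Y.submatrix id Fin.castSucc)
    (y : m → ℝ) (hy : y = fun i => Y i (Fin.last q))
    (hZZ : IsUnit (Zᵀ * Z).det) :
    c * (y ⬝ᵥ y - y ⬝ᵥ (Z *ᵥ ((Zᵀ * Z)⁻¹ *ᵥ (Zᵀ *ᵥ y)))) *
      A⁻¹ (Fin.last q) (Fin.last q) ^ 2 = 1 := by
  have horth := transpose_mulVec_residual Z y hZZ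
  rw [← dotProduct_sub]
  set v := (Zᵀ * Z)⁻¹ *ᵥ (Zᵀ *ᵥ y)
  set e := y - Z *ᵥ v with he
  let w : Fin (q + 1) → ℝ := Fin.snoc (-v) 1
  have hYw : Y *ᵥ w = e := by
    ext i
    simp [w, he, mulVec, dotProduct, Fin.sum_univ_castSucc, hZ, hy]
    ring
  have hYe : Yᵀ *ᵥ e = Pi.single (Fin.last q) (y ⬝ᵥ e) := by
    ext j
    refine Fin.lastCases ?_ (fun k => ?_) j
    · simp [mulVec, dotProduct, hy]
    · have h := congrFun horth k
      simpa [mulVec, dotProduct, hZ, (Fin.castSucc_lt_last k).ne] using h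
  have hu : A *ᵥ (Aᵀ *ᵥ w) = c • Pi.single (Fin.last q) (y ⬝ᵥ e) := by
    rw [mulVec_mulVec, ← hA, smul_mulVec, ← mulVec_mulVec, hYw, hYe]
  have hu' : Aᵀ *ᵥ w = A⁻¹ *ᵥ (c • Pi.single (Fin.last q) (y ⬝ᵥ e)) := by
    rw [← hu, mulVec_mulVec, nonsing_inv_mul _ hdet, one_mulVec]
  have hlast : A (Fin.last q) (Fin.last q) =
      c * ((y ⬝ᵥ e) * A⁻¹ (Fin.last q) (Fin.last q)) := by
    have h := congrFun hu' (Fin.last q)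
    rw [mulVec_smul, mulVec_single] at h
    simpa [w, mulVec, dotProduct, Fin.sum_univ_castSucc,
      hlow _ _ (Fin.castSucc_lt_last _), mul_comm] using h
  have hinv := inv_last_mul_last A hlow hdet
  rw [hlast] at hinv
  linear_combination hinv

/-- `1 - r_p² = 1 / (s_p² bₚₚ²)` where `r_p²` is the squared multiple
correlation coefficient of the p-th regressor with the remaining regressors, `s_p²` is
the data variance of the p-th regressor and `bₚₚ` is the (p,p) entry of `B`. -/
theorem one_minus_rsq_via_cholesky (n p : ℕ) (hn : 0 < n) (hp : 2 ≤ p)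
    (X : Matrix (Fin n) (Fin p) ℝ)
    (Xt : Matrix (Fin n) (Fin p) ℝ)
    (hXt : Xt = (1 - (n : ℝ)⁻¹ • Matrix.of (fun _ _ => (1 : ℝ))) * X)
    (hSpd : ((n : ℝ)⁻¹ • (Xtᵀ * Xt)).PosDef)
    (A : Matrix (Fin p) (Fin p) ℝ)
    (hAlow : ∀ i j : Fin p, i < j → A i j = 0)
    (hAdiag : ∀ i, 0 < A i i)
    (hA : (n : ℝ)⁻¹ • (Xtᵀ * Xt) = A * Aᵀ)
    (B : Matrix (Fin p) (Fin p) ℝ)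
    (hB : Bᵀ = A⁻¹)
    (lastIdx : Fin p) (hlast : (lastIdx : ℕ) = p - 1)
    (X1 : Matrix (Fin n) (Fin (p - 1)) ℝ)
    (hX1 : X1 = Xt.submatrix id (Fin.castLE (Nat.sub_le p 1)))
    (xp : Fin n → ℝ) (hxp : xp = fun i => Xt i lastIdx)
    (hX1X1 : IsUnit (X1ᵀ * X1).det)
    (rp2 : ℝ)
    (hrp2 : rp2 = (xp ⬝ᵥ (X1 *ᵥ ((X1ᵀ * X1)⁻¹ *ᵥ (X1ᵀ *ᵥ xp)))) / (xp ⬝ᵥ xp))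
    (sp2 : ℝ) (hsp2 : sp2 = (n : ℝ)⁻¹ * (xp ⬝ᵥ xp)) :
    1 - rp2 = 1 / (sp2 * (B lastIdx lastIdx) ^ 2) := by
  obtain ⟨q, rfl⟩ : ∃ q, p = q + 1 := ⟨p - 1, by omega⟩
  obtain rfl : lastIdx = Fin.last q := Fin.ext (by simpa using hlast)
  have hdet : IsUnit A.det := by
    have h := hSpd.det_pos.ne'
    rw [hA, det_mul] at h
    exact (left_ne_zero_of_mul h).isUnit
  have key := residual_mul_inv_last_sq (n : ℝ)⁻¹ Xt A hAlow hdet hA X1 hX1 xp hxp hX1X1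
  have hBlast : B (Fin.last q) (Fin.last q) = A⁻¹ (Fin.last q) (Fin.last q) := by
    rw [← hB, transpose_apply]
  have hyy : xp ⬝ᵥ xp ≠ 0 := by
    have h := (hSpd.diag_pos (i := Fin.last q)).ne'
    rw [Matrix.smul_apply, smul_eq_mul] at h
    rw [hxp]
    exact right_ne_zero_of_mul h
  rw [← hBlast] at key
  have hb : B (Fin.last q) (Fin.last q) ≠ 0 := by
    intro h
    simp [h] at key
  have hn' : (n : ℝ) ≠ 0 := by positivity
  rw [hrp2, hsp2, one_sub_div hyy, div_eq_div_iff hyy (by positivity)]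
  linear_combination (xp ⬝ᵥ xp) * key
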